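/- arXiv:1712.06514 — 4 statements merged into one kernel-verified Lean document; each statement's English description precedes it below -/
import Mathlib

section
/- Let E be a real Banach space, a < b reals, f, g : E → E continuous with g Lipschitz with constant L ≥ 0. Let z_f : [a,b] → E solve z′ = f(z), z(a) = η, and let z_g : [a,b] → E solve z′ = g(z), z(a) = κ. Then for every t ∈ [a,b], sup_{ξ∈[a,t]} ‖z_f(ξ) − z_g(ξ)‖ ≥ (1/(1 + L(t − a))) · ‖ η − κ − ∫_a^t (g − f)(z_f(ξ)) dξ ‖. -/
/-- On a compact set, the values of a nonnegative continuous function are bounded by its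
supremum, written as an iterated `⨆`. -/
theorem IsCompact.le_biSup_of_continuousOn {X : Type*} [TopologicalSpace X] {s : Set X}
    (hs : IsCompact s) {u : X → ℝ} (hu : ContinuousOn u s) (hu0 : ∀ x, 0 ≤ u x) {x : X}
    (hx : x ∈ s) : u x ≤ ⨆ y ∈ s, u y := by
  obtain ⟨C, hC⟩ := hs.bddAbove_image hu
  have hC0 : 0 ≤ C := (hu0 x).trans (hC ⟨x, hx, rfl⟩)
  have hbdd : BddAbove (Set.range fun y => ⨆ _ : y ∈ s, u y) := by
    refine ⟨C, ?_⟩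
    rintro _ ⟨y, rfl⟩
    exact Real.iSup_le (fun hy => hC ⟨y, hy, rfl⟩) hC0
  refine le_trans ?_ (le_ciSup hbdd x)
  simp [hx]


/-- Inequality (12): lower bound for the deviation of two solutions in terms of
the initial values and the integral of the difference of right-hand sides. -/
theorem stmt_1 {E : Type*} [NormedAddCommGroup E] [NormedSpace ℝ E] [CompleteSpace E]
    (a b : ℝ) (hab : a < b) (L : ℝ) (hL : 0 ≤ L)
    (f g : E → E) (hf : Continuous f) (hg : Continuous g)
    (hglip : ∀ y y2 : E, ‖g y - g y2‖ ≤ L * ‖y - y2‖)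
    (η κ : E) (zf zg : ℝ → E)
    (hzf : ∀ t ∈ Set.Icc a b, HasDerivWithinAt zf (f (zf t)) (Set.Icc a b) t)
    (hzg : ∀ t ∈ Set.Icc a b, HasDerivWithinAt zg (g (zg t)) (Set.Icc a b) t)
    (hzfa : zf a = η) (hzga : zg a = κ) :
    ∀ t ∈ Set.Icc a b,
      (1 / (1 + L * (t - a))) * ‖η - κ - ∫ ξ in a..t, (g (zf ξ) - f (zf ξ))‖ ≤
        ⨆ ξ ∈ Set.Icc a t, ‖zf ξ - zg ξ‖ := by
  intro t ht
  have hsub : Set.Icc a t ⊆ Set.Icc a b := Set.Icc_subset_Icc_right ht.2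
  have hzfc : ContinuousOn zf (Set.Icc a t) :=
    fun x hx => (hzf x (hsub hx)).continuousWithinAt.mono hsub
  have hzgc : ContinuousOn zg (Set.Icc a t) :=
    fun x hx => (hzg x (hsub hx)).continuousWithinAt.mono hsub
  have hle : ∀ ξ ∈ Set.Icc a t, ‖zf ξ - zg ξ‖ ≤ ⨆ ξ ∈ Set.Icc a t, ‖zf ξ - zg ξ‖ :=
    fun ξ hξ => isCompact_Icc.le_biSup_of_continuousOn (hzfc.sub hzgc).norm
      (fun _ => norm_nonneg _) hξ
  set S := ⨆ ξ ∈ Set.Icc a t, ‖zf ξ - zg ξ‖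
  have hfzf : IntervalIntegrable (fun ξ => f (zf ξ)) MeasureTheory.volume a t :=
    (hf.comp_continuousOn hzfc).intervalIntegrable_of_Icc ht.1
  have hgzf : IntervalIntegrable (fun ξ => g (zf ξ)) MeasureTheory.volume a t :=
    (hg.comp_continuousOn hzfc).intervalIntegrable_of_Icc ht.1
  have hgzg : IntervalIntegrable (fun ξ => g (zg ξ)) MeasureTheory.volume a t :=
    (hg.comp_continuousOn hzgc).intervalIntegrable_of_Icc ht.1
  have hnhds : ∀ x ∈ Set.Ioo a t, Set.Icc a b ∈ nhds x :=
    fun x hx => Icc_mem_nhds hx.1 (hx.2.trans_le ht.2)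
  have hFf : ∫ ξ in a..t, f (zf ξ) = zf t - zf a :=
    intervalIntegral.integral_eq_sub_of_hasDerivAt_of_le ht.1 hzfc
      (fun x hx => (hzf x (hsub (Set.Ioo_subset_Icc_self hx))).hasDerivAt (hnhds x hx)) hfzf
  have hFg : ∫ ξ in a..t, g (zg ξ) = zg t - zg a :=
    intervalIntegral.integral_eq_sub_of_hasDerivAt_of_le ht.1 hzgc
      (fun x hx => (hzg x (hsub (Set.Ioo_subset_Icc_self hx))).hasDerivAt (hnhds x hx)) hgzg
  have hdecomp : η - κ - ∫ ξ in a..t, (g (zf ξ) - f (zf ξ)) =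
      (zf t - zg t) - ∫ ξ in a..t, (g (zf ξ) - g (zg ξ)) := by
    rw [intervalIntegral.integral_sub hgzf hfzf, intervalIntegral.integral_sub hgzf hgzg,
      hFf, hFg, hzfa, hzga]
    abel
  have hint : ‖∫ ξ in a..t, (g (zf ξ) - g (zg ξ))‖ ≤ L * S * (t - a) := by
    rw [← abs_of_nonneg (sub_nonneg.2 ht.1)]
    refine intervalIntegral.norm_integral_le_of_norm_le_const fun ξ hξ => ?_
    rw [Set.uIoc_of_le ht.1] at hξ
    exact (hglip _ _).trans
      (mul_le_mul_of_nonneg_left (hle ξ (Set.Ioc_subset_Icc_self hξ)) hL)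
  have hpos : 0 < 1 + L * (t - a) := by
    have := mul_nonneg hL (sub_nonneg.2 ht.1)
    linarith
  rw [hdecomp, one_div, inv_mul_le_iff₀ hpos]
  calc _ ≤ ‖zf t - zg t‖ + ‖∫ ξ in a..t, (g (zf ξ) - g (zg ξ))‖ := norm_sub_le _ _
    _ ≤ S + L * S * (t - a) := add_le_add (hle t (Set.right_mem_Icc.2 ht.1)) hint
    _ = (1 + L * (t - a)) * S := by ring
end

section
/- Let E be a real Banach space, f : E → E Lipschitz with constant Λ > 0, y ∈ E, t₀ ∈ ℝ, h > 0, and r ≥ 1 an integer. Define l₀(t) ≡ y on [t₀, t₀+h], and for s = 0, 1, …, r−1 define l_{s+1}(t) = y + ∫_{t₀}^t q_s(ξ) dξ, where q_s(ξ) = Σ_{p=0}^{s} ( Π_{l≠p} (ξ − ξ_{s,l})/(ξ_{s,p} − ξ_{s,l}) ) • f(l_s(ξ_{s,p})) is the Lagrange interpolation polynomial of f ∘ l_s at the equidistant nodes ξ_{s,p} = t₀ + p h/s for p = 0,…,s (with q₀(ξ) ≡ f(y)). Let C_r = max_{0 ≤ s ≤ r−1} sup_{ξ∈[t₀,t₀+h]}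 Σ_{p=0}^{s} Π_{l≠p} |(ξ − ξ_{s,l})/(ξ_{s,p} − ξ_{s,l})|. If 2 h Λ C_r ≤ 1, then for every s = 0, 1, …, r, sup_{t∈[t₀,t₀+h]} ‖l_s(t) − y‖ ≤ 2 h ‖f(y)‖. -/
theorem Lagrange.sum_prod_div_eq_one {F ι : Type*} [Field F] [DecidableEq ι] {s : Finset ι}
    {v : ι → F} (hv : Set.InjOn v s) (hs : s.Nonempty) (x : F) :
    ∑ p ∈ s, ∏ m ∈ s.erase p, (x - v m) / (v p - v m) = 1 := by
  have key := congrArg (Polynomial.eval x) (Lagrange.sum_basis hv hs)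
  simpa [Polynomial.eval_finsetSum, Lagrange.basis, Polynomial.eval_prod,
    Lagrange.basisDivisor, div_eq_inv_mul] using key

theorem norm_sum_smul_le_of_sum_eq_one {ι E : Type*} [SeminormedAddCommGroup E] [NormedSpace ℝ E]
    {s : Finset ι} {w : ι → ℝ} {g : ι → E} {a : E} {B : ℝ} (hw : ∑ p ∈ s, w p = 1)
    (hg : ∀ p ∈ s, ‖g p - a‖ ≤ B) :
    ‖∑ p ∈ s, w p • g p‖ ≤ ‖a‖ + (∑ p ∈ s, |w p|) * B := by
  have hsplit : ∑ p ∈ s, w p • g p = a + ∑ p ∈ s, w p • (g p - a) := by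
    simp [smul_sub, Finset.sum_sub_distrib, ← Finset.sum_smul, hw]
  rw [hsplit, Finset.sum_mul]
  refine (norm_add_le _ _).trans (add_le_add_right (norm_sum_le_of_le _ fun p hp => ?_) _)
  rw [norm_smul, Real.norm_eq_abs]
  exact mul_le_mul_of_nonneg_left (hg p hp) (abs_nonneg _)

theorem injOn_equidistant_nodes (t₀ : ℝ) {h : ℝ} (hh : h ≠ 0) (s : ℕ) :
    Set.InjOn (fun m : ℕ => t₀ + (m : ℝ) * h / (s : ℝ)) (Finset.range (s + 1)) := by
  rcases Nat.eq_zero_or_pos s with rfl | hs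
  · simp
  · intro a _ b _ hab
    have hs' : (s : ℝ) ≠ 0 := by positivity
    simpa [hs', hh, div_left_inj'] using hab

theorem equidistant_node_mem_Icc (t₀ : ℝ) {h : ℝ} (hh : 0 ≤ h) {s p : ℕ} (hp : p ≤ s) :
    t₀ + (p : ℝ) * h / (s : ℝ) ∈ Set.Icc t₀ (t₀ + h) := by
  have hle : (p : ℝ) * h / (s : ℝ) ≤ h :=
    div_le_of_le_mul₀ (by positivity) hh (by rw [mul_comm h]; gcongr)
  exact ⟨le_add_of_nonneg_right (by positivity), by gcongr⟩

/-- Inequality (8) in the proof of Lemma 1: the iterated interpolation-integration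
approximations `l_s` of one step of the algorithm stay within `2h‖f(y)‖` of `y`,
provided `2hΛC_r ≤ 1`. The equidistant nodes are `ξ_{s,p} = t₀ + p h / s`
(for `s = 0` the interpolation polynomial is the constant `f(y)`; note that in
Lean `p * h / 0 = 0`, so the formula below also covers `s = 0` correctly). -/
theorem stmt_6 {E : Type*} [NormedAddCommGroup E] [NormedSpace ℝ E] [CompleteSpace E]
    (Λ : ℝ) (hΛ : 0 < Λ) (f : E → E)
    (hf : ∀ u v : E, ‖f u - f v‖ ≤ Λ * ‖u - v‖)
    (y : E) (t₀ h : ℝ) (hh : 0 < h) (r : ℕ) (hr : 1 ≤ r)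
    (l : ℕ → ℝ → E)
    (hl0 : ∀ t, l 0 t = y)
    (hls : ∀ s < r, ∀ t, l (s + 1) t = y + ∫ ξ in t₀..t,
        ∑ p ∈ Finset.range (s + 1),
          (∏ m ∈ (Finset.range (s + 1)).erase p,
              (ξ - (t₀ + (m : ℝ) * h / (s : ℝ))) /
                ((t₀ + (p : ℝ) * h / (s : ℝ)) - (t₀ + (m : ℝ) * h / (s : ℝ)))) •
            f (l s (t₀ + (p : ℝ) * h / (s : ℝ))))
    (Cr : ℝ)
    (hCr : ∀ s < r, ∀ ξ ∈ Set.Icc t₀ (t₀ + h),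
        ∑ p ∈ Finset.range (s + 1),
          ∏ m ∈ (Finset.range (s + 1)).erase p,
            |(ξ - (t₀ + (m : ℝ) * h / (s : ℝ))) /
              ((t₀ + (p : ℝ) * h / (s : ℝ)) - (t₀ + (m : ℝ) * h / (s : ℝ)))| ≤ Cr)
    (hsmall : 2 * h * Λ * Cr ≤ 1) :
    ∀ s ≤ r, ∀ t ∈ Set.Icc t₀ (t₀ + h), ‖l s t - y‖ ≤ 2 * h * ‖f y‖ := by
  intro s
  induction s with
  | zero => intro _ t _; rw [hl0, sub_self, norm_zero]; positivity
  | succ s ih =>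
    intro hs t ht
    rw [hls s hs t, add_sub_cancel_left]
    refine (intervalIntegral.norm_integral_le_of_norm_le_const (C := 2 * ‖f y‖)
      fun ξ hξ => ?_).trans ?_
    · rw [Set.uIoc_of_le ht.1] at hξ
      refine (norm_sum_smul_le_of_sum_eq_one (a := f y) (B := Λ * (2 * h * ‖f y‖))
        (Lagrange.sum_prod_div_eq_one (injOn_equidistant_nodes t₀ hh.ne' s) (by simp) ξ)
        fun p hp => (hf _ _).trans ?_).trans ?_
      · have hmem := equidistant_node_mem_Icc t₀ hh.le (Finset.mem_range_succ_iff.mp hp)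
        exact mul_le_mul_of_nonneg_left (ih (by omega) _ hmem) hΛ.le
      · simp only [Finset.abs_prod]
        have hC := mul_le_mul_of_nonneg_right (hCr s hs ξ ⟨hξ.1.le, hξ.2.trans ht.2⟩)
          (by positivity : 0 ≤ Λ * (2 * h * ‖f y‖))
        linarith [mul_le_mul_of_nonneg_right hsmall (norm_nonneg (f y))]
    · rw [abs_of_nonneg (sub_nonneg.mpr ht.1)]
      nlinarith [ht.2, norm_nonneg (f y)]
end

section
/- Let r ≥ 1 be an integer, let a < b be reals, and let M₁ > 0, D₁ > 0. Then there exists c > 0 such that for every integer n ≥ 1 and every finite set S ⊂ ℝ with at most n elements, there exists a function H : ℝ → ℝ of class C^r with the following properties: 0 ≤ H(x) ≤ M₁ for all x ∈ ℝ; |H^{(j)}(x)| ≤ D₁ for all x ∈ ℝ and j = 1, …, r; H^{(j)}(x) = 0 for every x ∈ S and every j = 0, 1, …, r; and ∫_a^b H(x) dx ≥ c · n^{−r}. -/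
open MeasureTheory Set Function

theorem exists_contDiff_support_Ioo_integral_pos :
    ∃ φ : ℝ → ℝ, (∀ s : ℕ, ContDiff ℝ s φ) ∧ (∀ x, 0 ≤ φ x) ∧ HasCompactSupport φ ∧
      tsupport φ ⊆ Ioo 0 1 ∧ 0 < ∫ x, φ x := by
  let f : ContDiffBump (1 / 2 : ℝ) := ⟨1 / 8, 1 / 4, by norm_num, by norm_num⟩
  refine ⟨f, fun s => f.contDiff, fun x => f.nonneg, f.hasCompactSupport, ?_, f.integral_pos⟩
  rw [f.tsupport_eq, Real.closedBall_eq_Icc]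
  intro x hx
  simp only [f, mem_Icc] at hx
  constructor <;> linarith [hx.1, hx.2]

theorem support_iteratedDeriv_subset_tsupport (φ : ℝ → ℝ) (j : ℕ) :
    support (iteratedDeriv j φ) ⊆ tsupport φ := by
  intro x hx
  refine support_iteratedFDeriv_subset (𝕜 := ℝ) j ?_
  intro h
  exact hx (by rw [iteratedDeriv_eq_iteratedFDeriv, h]; rfl)

theorem HasCompactSupport.exists_bound_iteratedDeriv {φ : ℝ → ℝ} (hc : HasCompactSupport φ)
    {r : ℕ} (hφ : ContDiff ℝ r φ) :
    ∃ C > (0 : ℝ), ∀ j ≤ r, ∀ x, |iteratedDeriv j φ x| ≤ C := by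
  have key : ∀ j : ℕ, ∃ C : ℝ, j ≤ r → ∀ x, |iteratedDeriv j φ x| ≤ C := by
    intro j
    by_cases hj : j ≤ r
    · have hcj : HasCompactSupport (iteratedDeriv j φ) :=
        hc.mono' (support_iteratedDeriv_subset_tsupport φ j)
      obtain ⟨C, hC⟩ := hcj.exists_bound_of_continuous
        (hφ.continuous_iteratedDeriv j (by exact_mod_cast hj))
      exact ⟨C, fun _ x => hC x⟩
    · exact ⟨0, fun h => absurd h hj⟩
  choose C hC using key
  refine ⟨1 + ∑ j ∈ Finset.range (r + 1), |C j|, by positivity, fun j hj x => ?_⟩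
  have h1 := Finset.single_le_sum (f := fun j => |C j|) (fun i _ => abs_nonneg _)
    (Finset.mem_range.2 (Nat.lt_succ_of_le hj))
  linarith [hC j hj x, le_abs_self (C j)]

/-- The integer translates of a function supported in `(0, 1)` do not overlap. -/
theorem abs_sum_translates_le {ψ : ℝ → ℝ} {C : ℝ} (hC : 0 ≤ C) (hs : support ψ ⊆ Ioo 0 1)
    (hb : ∀ x, |ψ x| ≤ C) (G : Finset ℕ) (y : ℝ) :
    |∑ k ∈ G, ψ (y - k)| ≤ C := by
  by_cases h : ∃ k ∈ G, ψ (y - k) ≠ 0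
  · obtain ⟨k, hk, hne⟩ := h
    rw [Finset.sum_eq_single_of_mem k hk]
    · exact hb _
    · intro l _ hlk
      by_contra hl
      have h1 := hs hne
      have h2 := hs hl
      simp only [mem_Ioo] at h1 h2
      have h3 : (l : ℝ) < k + 1 := by linarith
      have h4 : (k : ℝ) < l + 1 := by linarith
      norm_cast at h3 h4
      omega
  · push Not at h
    rw [Finset.sum_eq_zero h]
    simpa using hC

/-- Among the first `2 * n` unit cells, at least `n` have no point of `T` in their interior. -/
theorem exists_cells_avoiding (n : ℕ) (T : Finset ℝ) (hT : T.card ≤ n) :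
    ∃ G ⊆ Finset.range (2 * n), n ≤ G.card ∧ ∀ k ∈ G, ∀ t ∈ T, t - (k : ℝ) ∉ Ioo (0 : ℝ) 1 := by
  refine ⟨Finset.range (2 * n) \ T.image (fun t => ⌊t⌋₊), Finset.sdiff_subset, ?_, ?_⟩
  · have h1 := Finset.le_card_sdiff (T.image (fun t => ⌊t⌋₊)) (Finset.range (2 * n))
    have h2 : (T.image (fun t => ⌊t⌋₊)).card ≤ T.card := Finset.card_image_le
    rw [Finset.card_range] at h1
    omega
  · intro k hk t ht hmem
    refine (Finset.mem_sdiff.1 hk).2 (Finset.mem_image.2 ⟨t, ht, ?_⟩)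
    have hk0 : (0 : ℝ) ≤ k := k.cast_nonneg
    rw [Nat.floor_eq_iff (by linarith [hmem.1])]
    constructor <;> linarith [hmem.1, hmem.2]

theorem iteratedDeriv_sum_comp_mul_sub {φ : ℝ → ℝ} {j : ℕ} (hφ : ContDiff ℝ j φ)
    (A m p : ℝ) (G : Finset ℕ) (x : ℝ) :
    iteratedDeriv j (fun x => A * ∑ k ∈ G, φ (m * x - (p + k))) x =
      A * (m ^ j * ∑ k ∈ G, iteratedDeriv j φ (m * x - p - k)) := by
  rw [iteratedDeriv_const_mul_field, iteratedDeriv_fun_sum (fun k _ => by fun_prop),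
    Finset.mul_sum (a := m ^ j)]
  congr 1
  refine Finset.sum_congr rfl fun k _ => ?_
  rw [iteratedDeriv_comp_const_mul (f := fun y => φ (y - (p + k))) (by fun_prop),
    iteratedDeriv_comp_sub_const]
  simp only [sub_sub]

theorem integral_comp_mul_sub_of_support_subset {φ : ℝ → ℝ} (hs : support φ ⊆ Ioo 0 1)
    {a b m : ℝ} (hm : 0 < m) {N k : ℕ} (hmN : m * (b - a) = N) (hk : k < N) :
    ∫ x in a..b, φ (m * x - (m * a + k)) = m⁻¹ * ∫ x, φ x := by
  rw [intervalIntegral.integral_comp_mul_sub _ hm.ne', smul_eq_mul,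
    intervalIntegral.integral_eq_integral_of_support_subset]
  intro x hx
  have hx' := hs hx
  have hkN : (k : ℝ) + 1 ≤ N := by exact_mod_cast hk
  have hk0 : (0 : ℝ) ≤ k := k.cast_nonneg
  constructor <;> nlinarith [hx'.1, hx'.2]

/-- The bump-function construction of Case III in the proof of Theorem 2: a nonnegative
`C^r` function, bounded by `M₁`, with derivatives of orders `1,…,r` bounded by `D₁`,
vanishing to order `r` at every point of a given set of at most `n` points, and with
integral over `[a,b]` at least `c n^{-r}`. -/
theorem stmt_16 (r : ℕ) (hr : 1 ≤ r) (a b : ℝ) (hab : a < b)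
    (M₁ D₁ : ℝ) (hM₁ : 0 < M₁) (hD₁ : 0 < D₁) :
    ∃ c > (0 : ℝ), ∀ n : ℕ, 1 ≤ n → ∀ S : Finset ℝ, S.card ≤ n →
      ∃ H : ℝ → ℝ,
        ContDiff ℝ (r : ℕ) H ∧
        (∀ x : ℝ, 0 ≤ H x ∧ H x ≤ M₁) ∧
        (∀ x : ℝ, ∀ j : ℕ, 1 ≤ j → j ≤ r → |iteratedDeriv j H x| ≤ D₁) ∧
        (∀ x ∈ S, ∀ j : ℕ, j ≤ r → iteratedDeriv j H x = 0) ∧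
        c * (n : ℝ) ^ (-(r : ℝ)) ≤ ∫ x in a..b, H x := by
  obtain ⟨φ, hφ, hφ0, hφc, hφs, hI⟩ := exists_contDiff_support_Ioo_integral_pos
  obtain ⟨C, hC0, hC⟩ := hφc.exists_bound_iteratedDeriv (hφ r)
  set I := ∫ x, φ x
  have hsupp : ∀ j, support (iteratedDeriv j φ) ⊆ Ioo 0 1 := fun j =>
    (support_iteratedDeriv_subset_tsupport φ j).trans hφs
  have hba : 0 < b - a := sub_pos.2 hab
  set L := max 1 (b - a)
  have hL1 : 1 ≤ L := le_max_left _ _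
  set B := min M₁ D₁
  have hB : 0 < B := lt_min hM₁ hD₁
  set ε := B / (C * L ^ r)
  have hε : 0 < ε := by positivity
  have hεC : ε * L ^ r * C = B := by
    simp only [ε]
    field_simp
  refine ⟨ε * I * ((b - a) / 2) ^ (r + 1), by positivity, fun n hn S hS => ?_⟩
  have hn1 : (1 : ℝ) ≤ n := by exact_mod_cast hn
  have hn0 : (0 : ℝ) < n := by linarith
  set m : ℝ := 2 * n / (b - a) with hm_def
  have hm : 0 < m := by positivity
  have hmN : m * (b - a) = (2 * n : ℕ) := by
    push_cast
    rw [hm_def]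
    field_simp
  have hm_inv : m⁻¹ = (b - a) / 2 / n := by
    rw [hm_def]
    field_simp
  have hmL : m⁻¹ ≤ L := by
    refine le_trans ?_ (le_max_right 1 (b - a))
    rw [hm_inv, div_div, div_le_iff₀ (by positivity)]
    nlinarith
  obtain ⟨G, hG, hGn, hGS⟩ := exists_cells_avoiding n (S.image fun s => m * s - m * a)
    (Finset.card_image_le.trans hS)
  set A := ε * m⁻¹ ^ r
  have hA : 0 < A := by positivity
  have hD := fun (j : ℕ) (x : ℝ) => iteratedDeriv_sum_comp_mul_sub (hφ j) A m (m * a) G x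
  have hbound : ∀ j ≤ r, ∀ x,
      |iteratedDeriv j (fun x => A * ∑ k ∈ G, φ (m * x - (m * a + k))) x| ≤ B := by
    intro j hj x
    rw [hD, abs_mul A, abs_mul (m ^ j), abs_of_pos hA, abs_of_pos (pow_pos hm j), ← mul_assoc, ← hεC]
    have hAm : A * m ^ j ≤ ε * L ^ r := by
      obtain ⟨i, rfl⟩ := Nat.exists_eq_add_of_le' hj
      have h1 : A * m ^ j = ε * m⁻¹ ^ i := by
        simp only [A]
        rw [pow_add, mul_assoc, mul_assoc, ← mul_pow, inv_mul_cancel₀ hm.ne', one_pow, mul_one]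
      rw [h1]
      have h2 : m⁻¹ ^ i ≤ L ^ i := pow_le_pow_left₀ (by positivity) hmL i
      have h3 : L ^ i ≤ L ^ (i + j) := pow_le_pow_right₀ hL1 (Nat.le_add_right i j)
      exact mul_le_mul_of_nonneg_left (h2.trans h3) hε.le
    exact mul_le_mul hAm (abs_sum_translates_le hC0.le (hsupp j) (hC j hj) G _)
      (abs_nonneg _) (by positivity)
  refine ⟨fun x => A * ∑ k ∈ G, φ (m * x - (m * a + k)), ?_, ?_, ?_, ?_, ?_⟩
  · have := hφ r
    fun_prop
  · intro x
    refine ⟨mul_nonneg hA.le (Finset.sum_nonneg fun k _ => hφ0 _), ?_⟩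
    have h0 := hbound 0 (Nat.zero_le r) x
    rw [iteratedDeriv_zero] at h0
    exact (le_abs_self _).trans (h0.trans (min_le_left _ _))
  · exact fun x j _ hj => (hbound j hj x).trans (min_le_right _ _)
  · intro x hx j _
    rw [hD, Finset.sum_eq_zero, mul_zero, mul_zero]
    intro k hk
    by_contra hne
    exact hGS k hk _ (Finset.mem_image_of_mem _ hx) (hsupp j hne)
  · have hint : ∫ x in a..b, A * ∑ k ∈ G, φ (m * x - (m * a + k)) =
        A * (G.card * (m⁻¹ * I)) := by
      rw [intervalIntegral.integral_const_mul, intervalIntegral.integral_finsetSum]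
      · rw [Finset.sum_congr rfl fun k hk => integral_comp_mul_sub_of_support_subset
          ((subset_tsupport φ).trans hφs) hm hmN (Finset.mem_range.1 (hG hk)),
          Finset.sum_const, nsmul_eq_mul]
      · intro k _
        have := (hφ 0).continuous
        exact Continuous.intervalIntegrable (by fun_prop) _ _
    rw [hint, Real.rpow_neg hn0.le, Real.rpow_natCast]
    have hcard : (n : ℝ) ≤ G.card := by exact_mod_cast hGn
    calc ε * I * ((b - a) / 2) ^ (r + 1) * ((n : ℝ) ^ r)⁻¹
        = A * (n * (m⁻¹ * I)) := by
          simp only [A]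
          rw [hm_inv, div_pow _ (n : ℝ), pow_succ]
          generalize (b - a) / 2 = w
          field_simp
      _ ≤ A * (G.card * (m⁻¹ * I)) := by gcongr
end

section
/- Let p ∈ (1,∞) and let ℓ_p^w be the weighted space of real sequences with weights w_j = 1/j, i.e., sequences y = (y¹, y², …) with ‖y‖ = (Σ_{j=1}^∞ |y^j|^p j^{−p})^{1/p} < ∞; for N ∈ ℕ let P_N be the truncation projection keeping the first N coordinates. Let η ∈ ℓ_p^w with |η^j| ≤ 1 for all j, and for each j ≥ 1 let f^j : ℓ_p^w → ℝ satisfy |f^j(η)| ≤ 1 and |f^j(y) − f^j(ȳ)| ≤ ‖y − ȳ‖ for all y, ȳ ∈ ℓ_p^w; then f(y) = (f¹(y), f²(y), …) defines a Lipschitz map f : ℓ_p^w → ℓ_p^w and the problem z′(t) = f(z(t)), z(0) = η has a unique solution z : [0,1] → ℓ_p^w. Define the truncated Euler approximation on the uniform mesh t_k = k/n by ȳ₀ = P_N η, ȳ_{k+1} = ȳ_k + (1/n) P_N f(ȳ_k) for k = 0, …, n−1, and l(t) = ȳ_k + (t − t_k) P_N f(ȳ_k) for t ∈ [t_k, t_{k+1}].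 Then there exist constants A, B > 0 depending only on p such that for all integers n, N ≥ 1, sup_{t∈[0,1]} ‖z(t) − l(t)‖ ≤ A · N^{−(1−1/p)} + B/n. -/
open Set
open scoped NNReal ENNReal

section PiecewiseAffine

lemma floor_mul_mesh {n : ℕ} (hn : 1 ≤ n) {t : ℝ} (ht : t ∈ Ico (0 : ℝ) 1) :
    ⌊(n : ℝ) * t⌋₊ < n ∧
      t ∈ Ico ((⌊(n : ℝ) * t⌋₊ : ℝ) / n) (((⌊(n : ℝ) * t⌋₊ : ℝ) + 1) / n) := by
  have hn0 : (0 : ℝ) < n := by exact_mod_cast hn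
  have hnt : 0 ≤ (n : ℝ) * t := mul_nonneg hn0.le ht.1
  refine ⟨(Nat.floor_lt hnt).2 ?_, ?_, ?_⟩
  · nlinarith [ht.2]
  · rw [div_le_iff₀ hn0, mul_comm t]
    exact Nat.floor_le hnt
  · rw [lt_div_iff₀ hn0, mul_comm t]
    exact Nat.lt_floor_add_one _

variable {E : Type*} [NormedAddCommGroup E] [NormedSpace ℝ E] {n : ℕ} {y g : ℕ → E} {l : ℝ → E}

lemma continuousOn_of_piecewise_affine (hn : 1 ≤ n)
    (hl : ∀ k < n, ∀ t ∈ Icc ((k : ℝ) / n) (((k : ℝ) + 1) / n),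
      l t = y k + (t - (k : ℝ) / n) • g k) :
    ContinuousOn l (Icc 0 1) := by
  have hn0 : (0 : ℝ) < n := by exact_mod_cast hn
  have key : ∀ k ≤ n, ContinuousOn l (Icc 0 ((k : ℝ) / n)) := by
    intro k
    induction k with
    | zero => intro _; simp [continuousOn_singleton]
    | succ k ih =>
      intro hk
      have hpiece : ContinuousOn l (Icc ((k : ℝ) / n) (((k : ℝ) + 1) / n)) :=
        ContinuousOn.congr (f := fun t => y k + (t - (k : ℝ) / n) • g k)
          (by fun_prop) (hl k hk)
      have hle : (k : ℝ) / n ≤ ((k : ℝ) + 1) / n := by gcongr; linarith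
      have := (ih (by omega)).union_of_isClosed hpiece isClosed_Icc isClosed_Icc
      rw [Icc_union_Icc_eq_Icc (by positivity) hle] at this
      exact_mod_cast this
  simpa [div_self hn0.ne'] using key n le_rfl

lemma hasDerivWithinAt_of_piecewise_affine (hn : 1 ≤ n)
    (hl : ∀ k < n, ∀ t ∈ Icc ((k : ℝ) / n) (((k : ℝ) + 1) / n),
      l t = y k + (t - (k : ℝ) / n) • g k) {t : ℝ} (ht : t ∈ Ico (0 : ℝ) 1) :
    HasDerivWithinAt l (g ⌊(n : ℝ) * t⌋₊) (Ici t) t := by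
  obtain ⟨hk, hkt⟩ := floor_mul_mesh hn ht
  set k := ⌊(n : ℝ) * t⌋₊
  have haff : HasDerivAt (fun s : ℝ => y k + (s - (k : ℝ) / n) • g k) (g k) t := by
    simpa using (((hasDerivAt_id t).sub_const ((k : ℝ) / n)).smul_const (g k)).const_add (y k)
  refine haff.hasDerivWithinAt.congr_of_eventuallyEq ?_ (hl k hk t (Ico_subset_Icc_self hkt))
  filter_upwards [Icc_mem_nhdsGE hkt.2] with s hs
  exact hl k hk s ⟨hkt.1.trans hs.1, hs.2⟩

/-- Error of a piecewise affine approximation on the uniform mesh whose slopes `g k` differ from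
the vector field at the nodes by at most `ρ`. -/
lemma norm_sub_le_gronwallBound_of_piecewise_affine {F : E → E} {K : ℝ≥0} {z : ℝ → E}
    {δ ρ M : ℝ} (hF : LipschitzWith K F)
    (hz : ∀ t ∈ Icc (0 : ℝ) 1, HasDerivWithinAt z (F (z t)) (Icc (0 : ℝ) 1) t) (hn : 1 ≤ n)
    (hl : ∀ k < n, ∀ t ∈ Icc ((k : ℝ) / n) (((k : ℝ) + 1) / n),
      l t = y k + (t - (k : ℝ) / n) • g k)
    (hδ : ‖z 0 - y 0‖ ≤ δ) (hρ : ∀ k < n, ‖g k - F (y k)‖ ≤ ρ) (hM : ∀ k < n, ‖g k‖ ≤ M)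
    {t : ℝ} (ht : t ∈ Icc (0 : ℝ) 1) :
    ‖z t - l t‖ ≤ gronwallBound δ K (ρ + K * (M / n)) t := by
  have hn0 : (0 : ℝ) < n := by exact_mod_cast hn
  have hl0 : l 0 = y 0 := by simpa using hl 0 hn 0 ⟨by simp, by simp⟩
  have := dist_le_of_approx_trajectories_ODE (v := fun _ => F) (K := K) (f := z) (g := l)
    (f' := fun t => F (z t)) (g' := fun t => g ⌊(n : ℝ) * t⌋₊) (a := 0) (b := 1) (δ := δ)
    (εf := 0) (εg := ρ + K * (M / n)) (fun _ => hF)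
    (fun s hs => (hz s hs).continuousWithinAt)
    (fun s hs => ((hz s (Ico_subset_Icc_self hs)).mono_of_mem_nhdsWithin
      (Icc_mem_nhdsGE_of_mem hs)))
    (by simp)
    (continuousOn_of_piecewise_affine hn hl)
    (fun s hs => hasDerivWithinAt_of_piecewise_affine hn hl hs) ?_
    (by rwa [hl0, dist_eq_norm]) t ht
  · simpa [dist_eq_norm] using this
  · intro s hs
    obtain ⟨hk, hks⟩ := floor_mul_mesh hn hs
    set k := ⌊(n : ℝ) * s⌋₊
    refine (dist_triangle _ (F (y k)) _).trans (add_le_add ?_ ((hF.dist_le_mul _ _).trans ?_))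
    · rw [dist_eq_norm]; exact hρ k hk
    · gcongr
      rw [hl k hk s (Ico_subset_Icc_self hks), dist_self_add_right, norm_smul, Real.norm_eq_abs,
        abs_of_nonneg (by linarith [hks.1])]
      have hstep : s - (k : ℝ) / n ≤ 1 / n := by
        have := hks.2.le
        rw [add_div] at this
        linarith
      calc (s - (k : ℝ) / n) * ‖g k‖ ≤ 1 / n * M := by
            gcongr
            exact hM k hk
        _ = M / n := by ring

end PiecewiseAffine

section SequenceSpace

variable {q : ℝ≥0∞}

/-- The truncation projection keeping the coordinates `j < N`. -/
noncomputable def lpTrunc (N : ℕ) (u : lp (fun _ : ℕ => ℝ) q) : lp (fun _ : ℕ => ℝ) q :=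
  ⟨fun j => if j < N then u j else 0,
    (memℓp_zero ((finite_lt_nat N).subset fun j hj => by
      by_contra h
      exact hj (if_neg h))).of_exponent_ge zero_le⟩

@[simp] lemma lpTrunc_apply (N : ℕ) (u : lp (fun _ : ℕ => ℝ) q) (j : ℕ) :
    lpTrunc N u j = if j < N then u j else 0 := rfl

lemma norm_lpTrunc_le (hq : q ≠ 0) (N : ℕ) (u : lp (fun _ : ℕ => ℝ) q) :
    ‖lpTrunc N u‖ ≤ ‖u‖ := by
  refine lp.norm_mono hq fun j => ?_
  rw [lpTrunc_apply]
  split_ifs <;> simp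

lemma lp_norm_le_mul_of_abs_le [Fact (1 ≤ q)] {u v : lp (fun _ : ℕ => ℝ) q} {C : ℝ} (hC : 0 ≤ C)
    (h : ∀ j, |u j| ≤ C * |v j|) : ‖u‖ ≤ C * ‖v‖ := by
  have hq : q ≠ 0 := (zero_lt_one.trans_le Fact.out).ne'
  calc ‖u‖ ≤ ‖C • v‖ := lp.norm_mono hq fun j => by
        simpa [abs_mul, abs_of_nonneg hC] using h j
    _ = C * ‖v‖ := by rw [norm_smul, Real.norm_of_nonneg hC]

lemma norm_sub_lpTrunc_le_mul [Fact (1 ≤ q)] {u v : lp (fun _ : ℕ => ℝ) q} {C : ℝ} (hC : 0 ≤ C)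
    (h : ∀ j, |u j| ≤ C * |v j|) (N : ℕ) : ‖u - lpTrunc N u‖ ≤ C * ‖v - lpTrunc N v‖ := by
  refine lp_norm_le_mul_of_abs_le hC fun j => ?_
  by_cases hj : j < N <;> simp [hj, h j]

variable {p : ℝ}

lemma memℓp_one_div_add_one (hp : 1 < p) :
    Memℓp (fun j : ℕ => 1 / ((j : ℝ) + 1)) (ENNReal.ofReal p) := by
  refine memℓp_gen ?_
  rw [ENNReal.toReal_ofReal (by linarith)]
  have := (summable_nat_add_iff 1).2 (Real.summable_nat_rpow_inv.2 hp)
  refine this.congr fun j => ?_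
  have hj : (0 : ℝ) < (j : ℝ) + 1 := by positivity
  rw [Real.norm_of_nonneg (by positivity), one_div, Real.inv_rpow hj.le]
  push_cast
  rfl

/-- The weight sequence `1 / (j + 1)`. -/
noncomputable def lpHarmonic (hp : 1 < p) : lp (fun _ : ℕ => ℝ) (ENNReal.ofReal p) :=
  ⟨fun j => 1 / ((j : ℝ) + 1), memℓp_one_div_add_one hp⟩

@[simp] lemma lpHarmonic_apply (hp : 1 < p) (j : ℕ) :
    lpHarmonic hp j = 1 / ((j : ℝ) + 1) := rfl

lemma one_le_norm_lpHarmonic (hp : 1 < p) : 1 ≤ ‖lpHarmonic hp‖ := by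
  have hq : ENNReal.ofReal p ≠ 0 := by simpa using by linarith
  simpa using lp.norm_apply_le_norm hq (lpHarmonic hp) 0

lemma abs_div_add_one_le (hp : 1 < p) {a C : ℝ} (h : |a| ≤ C) (j : ℕ) :
    |a / ((j : ℝ) + 1)| ≤ C * |lpHarmonic hp j| := by
  have hj : (0 : ℝ) < (j : ℝ) + 1 := by positivity
  rw [lpHarmonic_apply, abs_div, abs_div, abs_one, abs_of_pos hj, mul_one_div]
  gcongr

lemma sum_range_rpow_neg_le (hp : 1 < p) {N : ℕ} (hN : 1 ≤ N) (a : ℕ) :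
    ∑ i ∈ Finset.range a, ((N : ℝ) + ((i + 1 : ℕ) : ℝ)) ^ (-p) ≤ (N : ℝ) ^ (1 - p) / (p - 1) := by
  have hN0 : (0 : ℝ) < N := by exact_mod_cast hN
  have hanti : AntitoneOn (fun x : ℝ => x ^ (-p)) (Icc (N : ℝ) (N + a)) := fun x hx y _ hxy =>
    Real.rpow_le_rpow_of_nonpos (hN0.trans_le hx.1) hxy (by linarith)
  refine hanti.sum_le_integral.trans ?_
  have h0 : (0 : ℝ) ∉ uIcc (N : ℝ) (N + a) := by
    rw [uIcc_of_le (by simp)]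
    exact fun h => hN0.not_ge h.1
  rw [integral_rpow (Or.inr ⟨by linarith, h0⟩), show -p + 1 = -(p - 1) by ring, div_neg, ← neg_div,
    show (1 : ℝ) - p = -(p - 1) by ring]
  have hp1 : 0 < p - 1 := by linarith
  gcongr
  have : (0 : ℝ) ≤ ((N : ℝ) + a) ^ (-(p - 1)) := by positivity
  linarith

lemma norm_lpHarmonic_sub_lpTrunc_le (hp : 1 < p) {N : ℕ} (hN : 1 ≤ N) :
    ‖lpHarmonic hp - lpTrunc N (lpHarmonic hp)‖ ≤
      (1 / (p - 1)) ^ (1 / p) * (N : ℝ) ^ (-(1 - 1 / p)) := by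
  have hp0 : 0 < p := by linarith
  have hp1 : 0 < p - 1 := by linarith
  have hN0 : (0 : ℝ) < N := by exact_mod_cast hN
  have htr : (ENNReal.ofReal p).toReal = p := ENNReal.toReal_ofReal hp0.le
  refine lp.norm_le_of_forall_sum_le (by rwa [htr]) (by positivity) fun s => ?_
  rw [htr]
  have hpow : ((1 / (p - 1)) ^ (1 / p) * (N : ℝ) ^ (-(1 - 1 / p))) ^ p =
      (N : ℝ) ^ (1 - p) / (p - 1) := by
    rw [Real.mul_rpow (by positivity) (by positivity), ← Real.rpow_mul (by positivity),
      ← Real.rpow_mul hN0.le, one_div_mul_cancel hp0.ne', Real.rpow_one,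
      show -(1 - 1 / p) * p = 1 - p by field_simp; ring]
    ring
  rw [hpow]
  obtain ⟨a, ha⟩ := s.exists_nat_subset_range
  have hsub : s ⊆ Finset.range (N + a) := ha.trans (Finset.range_mono (by omega))
  refine (Finset.sum_le_sum_of_subset_of_nonneg hsub fun _ _ _ => by positivity).trans ?_
  rw [Finset.sum_range_add, Finset.sum_eq_zero, zero_add]
  · refine (Finset.sum_le_sum fun i _ => ?_).trans (sum_range_rpow_neg_le hp hN a)
    have hi : (0 : ℝ) < (N : ℝ) + ((i + 1 : ℕ) : ℝ) := by positivity
    rw [Real.rpow_neg hi.le, ← Real.inv_rpow hi.le]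
    apply le_of_eq
    congr 1
    have hi' : (0 : ℝ) < (N : ℝ) + i + 1 := by positivity
    simp [add_assoc]
    positivity
  · intro i hi
    simp [Finset.mem_range.1 hi, Real.zero_rpow hp0.ne']

end SequenceSpace

/-- A discrete Gronwall estimate for the Euler recursion. -/
lemma one_add_le_mul_exp_of_step {W : ℝ} (hW : 0 ≤ W) {n : ℕ} {d : ℕ → ℝ} (h0 : d 0 ≤ W)
    (hstep : ∀ k < n, d (k + 1) ≤ d k + 1 / (n : ℝ) * (W * (1 + d k))) {k : ℕ} (hk : k ≤ n) :
    1 + d k ≤ (1 + W) * Real.exp W := by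
  have key : ∀ k ≤ n, 1 + d k ≤ (1 + W) * (1 + W / n) ^ k := by
    intro k
    induction k with
    | zero => intro _; simpa using h0
    | succ k ih =>
      intro hk
      have hw : 0 ≤ 1 + W / n := by positivity
      calc 1 + d (k + 1) ≤ (1 + d k) * (1 + W / n) := by
            have := hstep k hk
            have e : 1 / (n : ℝ) * (W * (1 + d k)) = (1 + d k) * (W / n) := by ring
            rw [e] at this
            linarith
        _ ≤ (1 + W) * (1 + W / n) ^ k * (1 + W / n) := by gcongr; exact ih (by omega)
        _ = (1 + W) * (1 + W / n) ^ (k + 1) := by ring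
  refine (key k hk).trans ?_
  gcongr
  calc (1 + W / n) ^ k ≤ Real.exp (W / n) ^ k := by
        gcongr
        linarith [Real.add_one_le_exp (W / n)]
    _ = Real.exp (k * (W / n)) := (Real.exp_nat_mul _ _).symm
    _ ≤ Real.exp W := by
        gcongr
        rcases Nat.eq_zero_or_pos n with rfl | hn
        · simpa using hW
        · have hn0 : (0 : ℝ) < n := by exact_mod_cast hn
          rw [mul_div_assoc', div_le_iff₀ hn0, mul_comm]
          gcongr

/-- The error bound for the truncated Euler algorithm in the weighted `ℓ_p` example
(Section 4 of the paper, case `r = 0` of Theorem 1), with weights `w_j = 1/j`.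

The weighted space `ℓ_p^w` is represented, via the isometry `y ↦ (w_j y^j)_j`, by the
standard sequence space `E = lp (fun _ : ℕ => ℝ) p` (indexing coordinates by `ℕ` from `0`,
so the weight of coordinate `j` is `1/(j+1)`).  For `u ∈ E`, the `j`-th component of the
original sequence is `(j+1) * u j`.  Thus:
* `|η^j| ≤ 1` reads `|(j+1) * η j| ≤ 1`;
* `f j : E → ℝ` is the `j`-th component `f^j` of the right-hand side, with `|f^j(η)| ≤ 1`
  and Lipschitz constant `1` w.r.t. the (weighted) norm;
* the induced map `F : E → E` has components `(F u) j = f j u / (j+1)`;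
* `P_N` keeps the coordinates `j < N`.
`z` is the solution of `z' = F(z)`, `z 0 = η` on `[0,1]`; `ybar` are the truncated Euler
iterates on the uniform mesh `t_k = k/n`, and `lfun` is the piecewise-linear Euler
approximation.  The conclusion is `sup_{t∈[0,1]} ‖z t - lfun t‖ ≤ A N^{-(1-1/p)} + B/n`
with `A, B > 0` depending only on `p`. -/
theorem stmt_17 (p : ℝ) (hp : 1 < p) [Fact (1 ≤ ENNReal.ofReal p)] :
    ∃ A B : ℝ, 0 < A ∧ 0 < B ∧
      ∀ (η : lp (fun _ : ℕ => ℝ) (ENNReal.ofReal p))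
        (f : ℕ → lp (fun _ : ℕ => ℝ) (ENNReal.ofReal p) → ℝ)
        (F : lp (fun _ : ℕ => ℝ) (ENNReal.ofReal p) → lp (fun _ : ℕ => ℝ) (ENNReal.ofReal p)),
        (∀ j : ℕ, |((j : ℝ) + 1) * η j| ≤ 1) →
        (∀ j : ℕ, |f j η| ≤ 1) →
        (∀ (j : ℕ) (u v : lp (fun _ : ℕ => ℝ) (ENNReal.ofReal p)),
          |f j u - f j v| ≤ ‖u - v‖) →
        (∀ (u : lp (fun _ : ℕ => ℝ) (ENNReal.ofReal p)) (j : ℕ),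
          F u j = f j u / ((j : ℝ) + 1)) →
        ∀ z : ℝ → lp (fun _ : ℕ => ℝ) (ENNReal.ofReal p),
          (∀ t ∈ Set.Icc (0 : ℝ) 1, HasDerivWithinAt z (F (z t)) (Set.Icc (0 : ℝ) 1) t) →
          z 0 = η →
        ∀ n N : ℕ, 1 ≤ n → 1 ≤ N →
        ∀ ybar : ℕ → lp (fun _ : ℕ => ℝ) (ENNReal.ofReal p),
          (∀ j : ℕ, ybar 0 j = if j < N then η j else 0) →
          (∀ k < n, ∀ j : ℕ, ybar (k + 1) j =
            if j < N then ybar k j + (1 / (n : ℝ)) * (f j (ybar k) / ((j : ℝ) + 1)) else 0) →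
        ∀ lfun : ℝ → lp (fun _ : ℕ => ℝ) (ENNReal.ofReal p),
          (∀ k < n, ∀ t ∈ Set.Icc ((k : ℝ) / (n : ℝ)) (((k : ℝ) + 1) / (n : ℝ)), ∀ j : ℕ,
            lfun t j = ybar k j +
              (t - (k : ℝ) / (n : ℝ)) *
                (if j < N then f j (ybar k) / ((j : ℝ) + 1) else 0)) →
        ∀ t ∈ Set.Icc (0 : ℝ) 1,
          ‖z t - lfun t‖ ≤ A * (N : ℝ) ^ (-(1 - 1 / p)) + B / (n : ℝ) := by
  have hp0 : 0 < p := by linarith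
  have hp1 : 0 < p - 1 := by linarith
  have hq : ENNReal.ofReal p ≠ 0 := by simpa using hp0
  set w := lpHarmonic hp with hw
  have hW1 : 1 ≤ ‖w‖ := one_le_norm_lpHarmonic hp
  set W := ‖w‖ with hWdef
  have hW0 : 0 < W := by linarith
  set C := (1 + W) * Real.exp W with hCdef
  have hC0 : 0 < C := by positivity
  set c := (1 / (p - 1)) ^ (1 / p) with hcdef
  have hc0 : 0 < c := by positivity
  refine ⟨c * (Real.exp W + C / W * Real.exp W), C * W * Real.exp W, by positivity,
    by positivity, ?_⟩
  intro η f F hη hfη hf hF z hz hz0 n N hn hN ybar hy0 hys lfun hl t ht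
  have hn0 : (0 : ℝ) < n := by exact_mod_cast hn
  have hηw : ∀ j, |η j| ≤ 1 * |w j| := fun j => by
    have hj : (j : ℝ) + 1 ≠ 0 := by positivity
    have := abs_div_add_one_le hp (hη j) j
    rwa [mul_div_cancel_left₀ _ hj] at this
  have hFlip : LipschitzWith ‖w‖₊ F := LipschitzWith.of_dist_le_mul fun u v => by
    rw [dist_eq_norm, dist_eq_norm, coe_nnnorm, mul_comm]
    refine lp_norm_le_mul_of_abs_le (norm_nonneg _) fun j => ?_
    rw [lp.coeFn_sub, Pi.sub_apply, hF, hF, ← sub_div]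
    exact abs_div_add_one_le hp (hf j u v) j
  have hFw : ∀ u j, |F u j| ≤ (1 + ‖u - η‖) * |w j| := fun u j => by
    rw [hF]
    refine abs_div_add_one_le hp ?_ j
    have h1 := hfη j
    have h2 := hf j u η
    have h3 := abs_add_le (f j η) (f j u - f j η)
    rw [add_sub_cancel] at h3
    linarith
  have hy0' : ybar 0 = lpTrunc N η := lp.ext (funext hy0)
  have hyN : ∀ k ≤ n, ∀ j, ¬ j < N → ybar k j = 0 := by
    rintro (_ | k) hk j hj
    · rw [hy0, if_neg hj]
    · rw [hys k hk, if_neg hj]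
  have hys' : ∀ k < n, ybar (k + 1) = ybar k + (1 / (n : ℝ)) • lpTrunc N (F (ybar k)) := by
    intro k hk
    refine lp.ext (funext fun j => ?_)
    rw [hys k hk, lp.coeFn_add, Pi.add_apply, lp.coeFn_smul, Pi.smul_apply, lpTrunc_apply]
    by_cases hj : j < N
    · simp [hj, hF]
    · simp [hj, hyN k hk.le j hj]
  have hl' : ∀ k < n, ∀ t ∈ Icc ((k : ℝ) / n) (((k : ℝ) + 1) / n),
      lfun t = ybar k + (t - (k : ℝ) / n) • lpTrunc N (F (ybar k)) := by
    intro k hk s hs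
    refine lp.ext (funext fun j => ?_)
    rw [hl k hk s hs, lp.coeFn_add, Pi.add_apply, lp.coeFn_smul, Pi.smul_apply, lpTrunc_apply, hF,
      smul_eq_mul]
  have hG : ∀ k, ‖lpTrunc N (F (ybar k))‖ ≤ W * (1 + ‖ybar k - η‖) := fun k => by
    rw [mul_comm]
    exact (norm_lpTrunc_le hq N _).trans (lp_norm_le_mul_of_abs_le (by positivity) (hFw _))
  have hT := norm_lpHarmonic_sub_lpTrunc_le hp hN
  rw [← hw, ← hcdef] at hT
  set T := ‖w - lpTrunc N w‖ with hTdef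
  have hT0 : 0 ≤ T := norm_nonneg _
  have hηT : ‖η - ybar 0‖ ≤ T := by
    rw [hy0']
    simpa using norm_sub_lpTrunc_le_mul zero_le_one hηw N
  have hTW : T ≤ W := by
    refine lp.norm_mono hq fun j => ?_
    by_cases hj : j < N <;> simp [hj]
  have hbound : ∀ k ≤ n, 1 + ‖ybar k - η‖ ≤ C := fun k hk =>
    one_add_le_mul_exp_of_step hW0.le (d := fun k => ‖ybar k - η‖)
      (by rw [norm_sub_rev]; exact hηT.trans hTW)
      (fun k hk => by
        rw [hys' k hk, add_sub_right_comm]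
        refine (norm_add_le _ _).trans ?_
        rw [norm_smul, Real.norm_of_nonneg (by positivity)]
        gcongr
        exact hG k) hk
  have hmain := norm_sub_le_gronwallBound_of_piecewise_affine hFlip hz hn hl'
    (δ := T) (by rwa [hz0]) (ρ := C * T) (M := W * C)
    (fun k hk => by
      rw [norm_sub_rev]
      refine norm_sub_lpTrunc_le_mul hC0.le (fun j => (hFw _ j).trans ?_) N
      gcongr
      exact hbound k hk.le)
    (fun k hk => (hG k).trans (by gcongr; exact hbound k hk.le)) ht
  refine hmain.trans ?_
  rw [coe_nnnorm, ← hWdef, gronwallBound_of_K_ne_0 hW0.ne']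
  have hexp : Real.exp (W * t) ≤ Real.exp W := by
    gcongr
    exact mul_le_of_le_one_right hW0.le ht.2
  beta_reduce
  calc T * Real.exp (W * t) + (C * T + W * (W * C / n)) / W * (Real.exp (W * t) - 1)
      ≤ T * Real.exp W + (C * T + W * (W * C / n)) / W * Real.exp W := by
        gcongr
        linarith
    _ = (Real.exp W + C / W * Real.exp W) * T + C * W * Real.exp W / n := by
        field_simp
        ring
    _ ≤ (Real.exp W + C / W * Real.exp W) * (c * (N : ℝ) ^ (-(1 - 1 / p))) +
          C * W * Real.exp W / n := by gcongr
    _ = _ := by ring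
end
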